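/- arXiv:2603.20792 — 3 statements merged into one kernel-verified Lean document; each statement's English description precedes it below -/
import Mathlib

section
/- For every n ≥ 1, the n-qubit phase-point operators form a basis of the complex matrix algebra: every 2ⁿ×2ⁿ complex matrix M satisfies the reconstruction formula M = ∑_{α ∈ ((ZMod 2)²)ⁿ} 2^(−n)·Tr(M·A_α)·A_α. Consequently the discrete Wigner transform M ↦ (α ↦ 2^(−n)·Tr(M·A_α)) is injective: if Tr(M·A_α) = 0 for all α then M = 0. -/
open Matrix Kronecker Finset
open scoped ComplexOrder

noncomputable section

def PX : Matrix (Fin 2) (Fin 2) ℂ := !![0, 1; 1, 0]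
def PY : Matrix (Fin 2) (Fin 2) ℂ := !![0, -Complex.I; Complex.I, 0]
def PZ : Matrix (Fin 2) (Fin 2) ℂ := !![1, 0; 0, -1]

/-- The single-qubit phase-point operator `A_{(q,p)}`. -/
def A1 (a : ZMod 2 × ZMod 2) : Matrix (Fin 2) (Fin 2) ℂ :=
  (1 / 2 : ℂ) • ((1 : Matrix (Fin 2) (Fin 2) ℂ)
    + ((-1 : ℂ) ^ a.2.val) • PX
    + ((-1 : ℂ) ^ (a.1.val + a.2.val)) • PY
    + ((-1 : ℂ) ^ a.1.val) • PZ)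

def pauli : Fin 4 → Matrix (Fin 2) (Fin 2) ℂ := ![1, PX, PY, PZ]

/-- The `n`-qubit phase-point operator `A_α`, a Kronecker product of single-qubit ones. -/
def phasePoint : (n : ℕ) → (Fin n → ZMod 2 × ZMod 2) → Matrix (Fin (2 ^ n)) (Fin (2 ^ n)) ℂ
  | 0, _ => 1
  | n + 1, α =>
      Matrix.reindex (finProdFinEquiv.trans (finCongr (by ring)))
        (finProdFinEquiv.trans (finCongr (by ring)))
        (A1 (α 0) ⊗ₖ phasePoint n fun i => α i.succ)

/-- An `n`-fold Kronecker product of Pauli matrices. -/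
def pauliTensor : (n : ℕ) → (Fin n → Fin 4) → Matrix (Fin (2 ^ n)) (Fin (2 ^ n)) ℂ
  | 0, _ => 1
  | n + 1, f =>
      Matrix.reindex (finProdFinEquiv.trans (finCongr (by ring)))
        (finProdFinEquiv.trans (finCongr (by ring)))
        (pauli (f 0) ⊗ₖ pauliTensor n fun i => f i.succ)

/-- The `n`-qubit Pauli group: phases `i^k` times tensor products of Paulis. -/
def PauliGroup (n : ℕ) : Set (Matrix (Fin (2 ^ n)) (Fin (2 ^ n)) ℂ) :=
  { M | ∃ (k : Fin 4) (f : Fin n → Fin 4), M = Complex.I ^ (k : ℕ) • pauliTensor n f }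

/-- `S` is an abelian subgroup of the Pauli group of size `2^n` with `-I ∉ S`. -/
def IsStabGroup (n : ℕ) (S : Finset (Matrix (Fin (2 ^ n)) (Fin (2 ^ n)) ℂ)) : Prop :=
  (∀ g ∈ S, g ∈ PauliGroup n) ∧
  (1 : Matrix (Fin (2 ^ n)) (Fin (2 ^ n)) ℂ) ∈ S ∧
  (∀ g ∈ S, ∀ h ∈ S, g * h ∈ S ∧ g * h = h * g) ∧
  S.card = 2 ^ n ∧
  (-1 : Matrix (Fin (2 ^ n)) (Fin (2 ^ n)) ℂ) ∉ S

/-- The set of pure `n`-qubit stabilizer states. -/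
def Stab (n : ℕ) : Set (Matrix (Fin (2 ^ n)) (Fin (2 ^ n)) ℂ) :=
  { σ | ∃ S : Finset (Matrix (Fin (2 ^ n)) (Fin (2 ^ n)) ℂ),
      IsStabGroup n S ∧ σ = ((2 : ℂ) ^ n)⁻¹ • ∑ g ∈ S, g }

/-- A density matrix: positive semidefinite with unit trace. -/
def IsDensity {d : ℕ} (ρ : Matrix (Fin d) (Fin d) ℂ) : Prop :=
  ρ.PosSemidef ∧ ρ.trace = 1

/-- The discrete Wigner function `W_ρ(α) = 2^{-n} Tr(ρ A_α)` (real part). -/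
def Wig (n : ℕ) (ρ : Matrix (Fin (2 ^ n)) (Fin (2 ^ n)) ℂ)
    (α : Fin n → ZMod 2 × ZMod 2) : ℝ :=
  (((2 : ℂ) ^ n)⁻¹ * (ρ * phasePoint n α).trace).re

/-- The free Wigner polytope: convex hull of stabilizer Wigner functions. -/
def WFree (n : ℕ) : Set ((Fin n → ZMod 2 × ZMod 2) → ℝ) :=
  convexHull ℝ { w | ∃ σ ∈ Stab n, w = Wig n σ }

/-- The ℓ¹ norm on phase-space functions. -/
def l1 {n : ℕ} (v : (Fin n → ZMod 2 × ZMod 2) → ℝ) : ℝ := ∑ α, |v α|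

/-- The Wigner distance `C(ρ)`: ℓ¹ distance from `W_ρ` to the free polytope. -/
def Cdist (n : ℕ) (ρ : Matrix (Fin (2 ^ n)) (Fin (2 ^ n)) ℂ) : ℝ :=
  sInf { d | ∃ f ∈ WFree n, d = l1 (Wig n ρ - f) }

/-- The stabilizer extent `Γ(ρ)`. -/
def Gam (n : ℕ) (ρ : Matrix (Fin (2 ^ n)) (Fin (2 ^ n)) ℂ) : ℝ :=
  sInf { t | ∃ (k : ℕ) (a : Fin k → ℝ) (s : Fin k → Matrix (Fin (2 ^ n)) (Fin (2 ^ n)) ℂ),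
      (∀ i, s i ∈ Stab n) ∧ ρ = ∑ i, a i • s i ∧ t = ∑ i, |a i| }

/-- Kronecker product with index bookkeeping `Fin (2^n) × Fin (2^m) ≃ Fin (2^(n+m))`. -/
def kron {n m : ℕ} (M : Matrix (Fin (2 ^ n)) (Fin (2 ^ n)) ℂ)
    (N : Matrix (Fin (2 ^ m)) (Fin (2 ^ m)) ℂ) :
    Matrix (Fin (2 ^ (n + m))) (Fin (2 ^ (n + m))) ℂ :=
  Matrix.reindex (finProdFinEquiv.trans (finCongr (pow_add 2 n m).symm))
    (finProdFinEquiv.trans (finCongr (pow_add 2 n m).symm)) (M ⊗ₖ N)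

/-- Single-qubit completeness: `∑ₐ Aₐ ⊗ Aₐ` is twice the swap operator. -/
theorem sum_A1_mul_A1 (i j k l : Fin 2) :
    ∑ a : ZMod 2 × ZMod 2, A1 a i j * A1 a k l = if i = l ∧ j = k then 2 else 0 := by
  have hu : (Finset.univ : Finset (ZMod 2)) = {0, 1} := rfl
  have h1 : (1 : ZMod 2).val = 1 := rfl
  rw [Fintype.sum_prod_type]
  simp only [hu, Finset.sum_pair (zero_ne_one : (0 : ZMod 2) ≠ 1)]
  fin_cases i <;> fin_cases j <;> fin_cases k <;> fin_cases l <;>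
    simp [A1, PX, PY, PZ, h1] <;> ring_nf <;> simp <;> norm_num

/-- Completeness: `∑_α A_α ⊗ A_α` is `2ⁿ` times the swap operator. -/
theorem sum_phasePoint_mul_phasePoint (n : ℕ) (i j k l : Fin (2 ^ n)) :
    ∑ α : Fin n → ZMod 2 × ZMod 2, phasePoint n α i j * phasePoint n α k l =
      if i = l ∧ j = k then (2 : ℂ) ^ n else 0 := by
  induction n with
  | zero =>
    have : Subsingleton (Fin (2 ^ 0)) := inferInstanceAs (Subsingleton (Fin 1))
    simp [phasePoint, Matrix.one_apply, eq_iff_true_of_subsingleton]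
  | succ n ih =>
    have h : 2 * 2 ^ n = 2 ^ (n + 1) := by ring
    obtain ⟨⟨i₁, i₂⟩, rfl⟩ := (finProdFinEquiv.trans (finCongr h)).surjective i
    obtain ⟨⟨j₁, j₂⟩, rfl⟩ := (finProdFinEquiv.trans (finCongr h)).surjective j
    obtain ⟨⟨k₁, k₂⟩, rfl⟩ := (finProdFinEquiv.trans (finCongr h)).surjective k
    obtain ⟨⟨l₁, l₂⟩, rfl⟩ := (finProdFinEquiv.trans (finCongr h)).surjective l
    rw [← (Fin.consEquiv fun _ : Fin (n + 1) => ZMod 2 × ZMod 2).sum_comp,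
      Fintype.sum_prod_type]
    simp only [phasePoint, Matrix.reindex_apply, Matrix.submatrix_apply, Equiv.symm_apply_apply,
      Matrix.kroneckerMap_apply, Fin.consEquiv_apply, Fin.cons_zero, Fin.cons_succ,
      mul_mul_mul_comm (A1 _ _ _), ← Finset.mul_sum, ih, ← Finset.sum_mul, sum_A1_mul_A1,
      EmbeddingLike.apply_eq_iff_eq, Prod.mk.injEq, pow_succ']
    split_ifs <;> simp_all

/-- the phase-point operators yield the reconstruction formula,
and the discrete Wigner transform is injective. -/
theorem phasePoint_reconstruction_and_injective (n : ℕ) (hn : 1 ≤ n)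
    (M : Matrix (Fin (2 ^ n)) (Fin (2 ^ n)) ℂ) :
    (M = ∑ α : Fin n → ZMod 2 × ZMod 2,
        (((2 : ℂ) ^ n)⁻¹ * (M * phasePoint n α).trace) • phasePoint n α) ∧
    ((∀ α : Fin n → ZMod 2 × ZMod 2, (M * phasePoint n α).trace = 0) → M = 0) := by
  have key : M = ∑ α : Fin n → ZMod 2 × ZMod 2,
      (((2 : ℂ) ^ n)⁻¹ * (M * phasePoint n α).trace) • phasePoint n α := by
    ext k l
    have hswap : ∀ i j : Fin (2 ^ n),
        ∑ α : Fin n → ZMod 2 × ZMod 2,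
          ((2 : ℂ) ^ n)⁻¹ * (M i j * phasePoint n α j i) * phasePoint n α k l =
        if j = l ∧ i = k then M i j else 0 := by
      intro i j
      simp_rw [mul_assoc, ← Finset.mul_sum]
      rw [sum_phasePoint_mul_phasePoint]
      split_ifs
      · field_simp
      · simp
    simp only [Matrix.sum_apply, Matrix.smul_apply, smul_eq_mul, Matrix.trace, Matrix.diag_apply,
      Matrix.mul_apply, Finset.mul_sum, Finset.sum_mul]
    rw [Finset.sum_comm]
    simp_rw [Finset.sum_comm (s := (Finset.univ : Finset (Fin n → ZMod 2 × ZMod 2))), hswap,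
      ite_and]
    simp
  refine ⟨key, fun h => ?_⟩
  rw [key]
  simp [h]
end
end

section
/- For every n ≥ 1 and every density matrix ρ on ℂ^(2ⁿ), the Wigner distance vanishes exactly on mixtures of stabilizer states: C(ρ) = 0 if and only if ρ lies in the convex hull of Stabₙ. -/
open Matrix Kronecker Finset
open scoped ComplexOrder

noncomputable section

def qubitSplit (n : ℕ) : Fin 2 × Fin (2 ^ n) ≃ Fin (2 ^ (n + 1)) :=
  finProdFinEquiv.trans (finCongr (by ring))

theorem phasePoint_succ (n : ℕ) (α : Fin (n + 1) → ZMod 2 × ZMod 2) :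
    phasePoint (n + 1) α = (A1 (α 0) ⊗ₖ phasePoint n fun i => α i.succ).submatrix
      (qubitSplit n).symm (qubitSplit n).symm := rfl

theorem pauliTensor_succ (n : ℕ) (f : Fin (n + 1) → Fin 4) :
    pauliTensor (n + 1) f = (pauli (f 0) ⊗ₖ pauliTensor n fun i => f i.succ).submatrix
      (qubitSplit n).symm (qubitSplit n).symm := rfl

theorem isHermitian_submatrix_kronecker {l m k : Type*} {A : Matrix l l ℂ} {B : Matrix m m ℂ}
    (hA : A.IsHermitian) (hB : B.IsHermitian) (e : k → l × m) :
    ((A ⊗ₖ B).submatrix e e).IsHermitian := by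
  refine IsHermitian.submatrix ?_ e
  rw [IsHermitian, conjTranspose_kronecker, hA.eq, hB.eq]

theorem A1_isHermitian (a : ZMod 2 × ZMod 2) : (A1 a).IsHermitian := by
  ext i j
  fin_cases i <;> fin_cases j <;> simp [A1, PX, PY, PZ] <;> ring

theorem pauli_isHermitian (i : Fin 4) : (pauli i).IsHermitian := by
  ext a b
  fin_cases i <;> fin_cases a <;> fin_cases b <;> simp [pauli, PX, PY, PZ]

theorem pauli_mul_self (i : Fin 4) : pauli i * pauli i = 1 := by
  ext a b
  fin_cases i <;> fin_cases a <;> fin_cases b <;>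
    simp [pauli, PX, PY, PZ, Matrix.mul_apply, Fin.sum_univ_two]

theorem phasePoint_isHermitian (n : ℕ) (α : Fin n → ZMod 2 × ZMod 2) :
    (phasePoint n α).IsHermitian := by
  induction n with
  | zero => exact isHermitian_one
  | succ n ih =>
    rw [phasePoint_succ]
    exact isHermitian_submatrix_kronecker (A1_isHermitian _) (ih _) _

theorem pauliTensor_isHermitian (n : ℕ) (f : Fin n → Fin 4) :
    (pauliTensor n f).IsHermitian := by
  induction n with
  | zero => exact isHermitian_one
  | succ n ih =>
    rw [pauliTensor_succ]
    exact isHermitian_submatrix_kronecker (pauli_isHermitian _) (ih _) _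

theorem pauliTensor_mul_self (n : ℕ) (f : Fin n → Fin 4) :
    pauliTensor n f * pauliTensor n f = 1 := by
  induction n with
  | zero => exact one_mul _
  | succ n ih =>
    rw [pauliTensor_succ, submatrix_mul_equiv, ← mul_kronecker_mul, pauli_mul_self, ih,
      one_kronecker_one, submatrix_one_equiv]

theorem eq_zero_of_sum_A1_mul_eq_zero (m : Fin 2 → Fin 2 → ℂ)
    (h : ∀ a, ∑ i, ∑ j, m i j * A1 a j i = 0) : m = 0 := by
  have h00 := h (0, 0)
  have h01 := h (0, 1)
  have h10 := h (1, 0)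
  have h11 := h (1, 1)
  simp only [A1, PX, PY, PZ, Fin.sum_univ_two, Matrix.smul_apply, Matrix.add_apply,
    ZMod.val_zero, ZMod.val_one] at h00 h01 h10 h11
  norm_num at h00 h01 h10 h11
  have hI := Complex.I_sq
  ext i j
  fin_cases i <;> fin_cases j <;> simp only [Fin.zero_eta, Fin.mk_one, Pi.zero_apply]
  · linear_combination (h00 + h01) / 2
  · linear_combination ((1 - Complex.I) * h00 - (1 - Complex.I) * h01
      + (1 + Complex.I) * h10 - (1 + Complex.I) * h11) / 4 + (m 0 1 - m 1 0) / 2 * hI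
  · linear_combination ((1 + Complex.I) * h00 - (1 + Complex.I) * h01
      + (1 - Complex.I) * h10 - (1 - Complex.I) * h11) / 4 + (m 1 0 - m 0 1) / 2 * hI
  · linear_combination (h10 + h11) / 2

theorem trace_mul_kronecker {m : Type*} [Fintype m] (M : Matrix (Fin 2 × m) (Fin 2 × m) ℂ)
    (A : Matrix (Fin 2) (Fin 2) ℂ) (B : Matrix m m ℂ) :
    (M * (A ⊗ₖ B)).trace =
      ((∑ i, ∑ j, A j i • M.submatrix (Prod.mk i) (Prod.mk j)) * B).trace := by
  simp only [Matrix.trace, Matrix.diag, Matrix.mul_apply, Fintype.sum_prod_type,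
    Fin.sum_univ_two, kroneckerMap_apply, Matrix.add_apply, Matrix.smul_apply,
    submatrix_apply, smul_eq_mul, ← Finset.sum_add_distrib]
  exact Finset.sum_congr rfl fun _ _ => Finset.sum_congr rfl fun _ _ => by ring

theorem trace_submatrix_equiv {l m : Type*} [Fintype l] [Fintype m] (A : Matrix m m ℂ)
    (e : l ≃ m) : (A.submatrix e e).trace = A.trace :=
  e.sum_comp fun i => A i i

/-- The phase-point operators span all matrices. -/
theorem eq_zero_of_trace_mul_phasePoint_eq_zero (n : ℕ)
    (M : Matrix (Fin (2 ^ n)) (Fin (2 ^ n)) ℂ)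
    (h : ∀ α, (M * phasePoint n α).trace = 0) : M = 0 := by
  induction n with
  | zero =>
    have h0 := h 0
    rw [phasePoint, mul_one] at h0
    have : Subsingleton (Fin (2 ^ 0)) := inferInstanceAs (Subsingleton (Fin 1))
    ext i j
    rw [Subsingleton.elim j i]
    rwa [Matrix.trace, Fintype.sum_subsingleton _ i] at h0
  | succ n ih =>
    set e := qubitSplit n
    have hM : M = (M.submatrix e e).submatrix e.symm e.symm := by simp
    have key (a : ZMod 2 × ZMod 2) : ∑ i, ∑ j, A1 a j i •
        (M.submatrix e e).submatrix (Prod.mk i) (Prod.mk j) = 0 := by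
      refine ih _ fun α => ?_
      have := h (Fin.cons a α)
      rw [phasePoint_succ, hM, submatrix_mul_equiv, trace_submatrix_equiv,
        trace_mul_kronecker] at this
      simpa using this
    rw [hM]
    suffices M.submatrix e e = 0 by rw [this]; rfl
    ext ⟨i, x⟩ ⟨j, y⟩
    refine congr_fun₂ (eq_zero_of_sum_A1_mul_eq_zero
      (fun i j => M.submatrix e e (i, x) (j, y)) fun a => ?_) i j
    have := congr_fun₂ (key a) x y
    simpa [Matrix.sum_apply, mul_comm] using this

theorem trace_mul_im_eq_zero {m : Type*} [Fintype m] {A B : Matrix m m ℂ}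
    (hA : A.IsHermitian) (hB : B.IsHermitian) : ((A * B).trace).im = 0 := by
  rw [← Complex.conj_eq_iff_im, starRingEnd_apply, ← trace_conjTranspose,
    conjTranspose_mul, hA.eq, hB.eq, trace_mul_comm]

def wigLinear (n : ℕ) : Matrix (Fin (2 ^ n)) (Fin (2 ^ n)) ℂ →ₗ[ℝ]
    ((Fin n → ZMod 2 × ZMod 2) → ℝ) where
  toFun := Wig n
  map_add' A B := by
    ext α
    simp only [Wig, add_mul, trace_add, mul_add, Complex.add_re, Pi.add_apply]
  map_smul' c A := by
    ext α
    simp only [Wig, smul_mul, trace_smul, mul_smul_comm, Complex.smul_re, Pi.smul_apply,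
      RingHom.id_apply]

theorem eq_of_wig_eq {n : ℕ} {A B : Matrix (Fin (2 ^ n)) (Fin (2 ^ n)) ℂ}
    (hA : A.IsHermitian) (hB : B.IsHermitian) (h : Wig n A = Wig n B) : A = B := by
  have hAB : wigLinear n (A - B) = 0 := by
    rw [map_sub]
    exact sub_eq_zero.2 h
  refine sub_eq_zero.1 (eq_zero_of_trace_mul_phasePoint_eq_zero n _ fun α => ?_)
  have him := trace_mul_im_eq_zero (hA.sub hB) (phasePoint_isHermitian n α)
  have hre : (((2 : ℂ) ^ n)⁻¹ * ((A - B) * phasePoint n α).trace).re = 0 := congr_fun hAB α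
  have h2 : ((2 : ℂ) ^ n)⁻¹ = (((2 : ℝ) ^ n)⁻¹ : ℝ) := by push_cast; rfl
  rw [h2, Complex.re_ofReal_mul] at hre
  exact Complex.ext ((mul_eq_zero.1 hre).resolve_left (by positivity)) him

theorem IsStabGroup.isHermitian {n : ℕ} {S : Finset (Matrix (Fin (2 ^ n)) (Fin (2 ^ n)) ℂ)}
    (hS : IsStabGroup n S) {g : Matrix (Fin (2 ^ n)) (Fin (2 ^ n)) ℂ} (hg : g ∈ S) :
    g.IsHermitian := by
  obtain ⟨hP, -, hmul, -, hneg⟩ := hS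
  obtain ⟨k, f, rfl⟩ := hP g hg
  have hsq := (hmul _ hg _ hg).1
  rw [smul_mul_smul_comm, pauliTensor_mul_self] at hsq
  have hf := pauliTensor_isHermitian n f
  have hsm (c : ℂ) (hc : star c = c) : (c • pauliTensor n f).IsHermitian := by
    rw [IsHermitian, conjTranspose_smul, hf.eq, hc]
  fin_cases k
  · exact hsm _ (by simp)
  · exact absurd hsq (by simpa using hneg)
  · exact hsm _ (by simp)
  · refine absurd hsq ?_
    have : Complex.I ^ 3 * Complex.I ^ 3 = -1 := by
      rw [Complex.I_pow_three]; simp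
    simpa [this] using hneg

theorem isHermitian_of_mem_stab {n : ℕ} {σ : Matrix (Fin (2 ^ n)) (Fin (2 ^ n)) ℂ}
    (hσ : σ ∈ Stab n) : σ.IsHermitian := by
  obtain ⟨S, hS, rfl⟩ := hσ
  rw [IsHermitian, conjTranspose_smul, conjTranspose_sum,
    Finset.sum_congr rfl fun g hg => (hS.isHermitian hg).eq]
  simp

theorem isHermitian_of_mem_convexHull_stab {n : ℕ} {σ : Matrix (Fin (2 ^ n)) (Fin (2 ^ n)) ℂ}
    (hσ : σ ∈ convexHull ℝ (Stab n)) : σ.IsHermitian :=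
  convexHull_min (t := (selfAdjoint.submodule ℝ (Matrix (Fin (2 ^ n)) (Fin (2 ^ n)) ℂ) : Set _))
    (fun _ h => isHermitian_of_mem_stab h) (Submodule.convex _) hσ

theorem finite_pauliGroup (n : ℕ) : (PauliGroup n).Finite := by
  refine (Set.finite_range fun p : Fin 4 × (Fin n → Fin 4) =>
    Complex.I ^ (p.1 : ℕ) • pauliTensor n p.2).subset ?_
  rintro _ ⟨k, f, rfl⟩
  exact ⟨(k, f), rfl⟩

theorem finite_stab (n : ℕ) : (Stab n).Finite := by
  refine ((finite_pauliGroup n).toFinset.powerset.finite_toSet.image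
    fun S => ((2 : ℂ) ^ n)⁻¹ • ∑ g ∈ S, g).subset ?_
  rintro _ ⟨S, hS, rfl⟩
  refine ⟨S, ?_, rfl⟩
  simpa [Set.subset_def] using hS.1

/-- The Pauli string with `Z` on the support of `f` and identities elsewhere. -/
def zTensor (n : ℕ) (f : Fin n → ZMod 2) : Matrix (Fin (2 ^ n)) (Fin (2 ^ n)) ℂ :=
  pauliTensor n fun i => if f i = 0 then 0 else 3

theorem pauli_z_mul (a b : ZMod 2) :
    pauli (if a = 0 then 0 else 3) * pauli (if b = 0 then 0 else 3)
      = pauli (if a + b = 0 then 0 else 3) := by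
  have h (c : ZMod 2) : c = 0 ∨ c = 1 := by decide +revert
  have h3 := pauli_mul_self 3
  have h0 : pauli 0 = 1 := rfl
  rcases h a with rfl | rfl <;> rcases h b with rfl | rfl <;>
    simp [h0, h3, CharTwo.add_self_eq_zero]

theorem zTensor_mul (n : ℕ) (f g : Fin n → ZMod 2) :
    zTensor n f * zTensor n g = zTensor n (f + g) := by
  induction n with
  | zero => exact one_mul _
  | succ n ih =>
    have := ih (fun i => f i.succ) (fun i => g i.succ)
    simp only [zTensor] at this ⊢
    rw [pauliTensor_succ, pauliTensor_succ, submatrix_mul_equiv, ← mul_kronecker_mul,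
      pauli_z_mul, this]
    rfl

theorem zTensor_zero (n : ℕ) : zTensor n 0 = 1 := by
  rw [← add_zero (0 : Fin n → ZMod 2), ← zTensor_mul]
  exact pauliTensor_mul_self n _

theorem trace_zTensor (n : ℕ) (f : Fin n → ZMod 2) (hf : f ≠ 0) : (zTensor n f).trace = 0 := by
  induction n with
  | zero => exact absurd (Subsingleton.elim _ _) hf
  | succ n ih =>
    rw [zTensor, pauliTensor_succ, trace_submatrix_equiv, trace_kronecker]
    by_cases h0 : f 0 = 0
    · refine mul_eq_zero_of_right _ (ih (fun i => f i.succ) fun h => hf ?_)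
      ext i
      refine Fin.cases h0 (fun i => congr_fun h i) i
    · refine mul_eq_zero_of_left ?_ _
      simp [h0, pauli, PZ, Matrix.trace, Fin.sum_univ_two]

theorem eq_zero_of_zTensor_eq_smul_one {n : ℕ} {f : Fin n → ZMod 2} {c : ℂ} (hc : c ≠ 0)
    (h : zTensor n f = c • 1) : f = 0 := by
  by_contra hf
  have := trace_zTensor n f hf
  simp [h, hc] at this

theorem zTensor_injective (n : ℕ) : Function.Injective (zTensor n) := by
  intro f g h
  have h1 : zTensor n (f + g) = (1 : ℂ) • 1 := by
    rw [← zTensor_mul, h, one_smul]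
    exact pauliTensor_mul_self n _
  have := eq_zero_of_zTensor_eq_smul_one one_ne_zero h1
  exact funext fun i => CharTwo.add_eq_zero.1 (congr_fun this i)

theorem stab_nonempty (n : ℕ) : (Stab n).Nonempty := by
  refine ⟨_, Finset.univ.map ⟨zTensor n, zTensor_injective n⟩, ⟨?_, ?_, ?_, ?_, ?_⟩, rfl⟩
  · intro g hg
    obtain ⟨f, -, rfl⟩ := Finset.mem_map.1 hg
    exact ⟨0, fun i => if f i = 0 then 0 else 3, by simp [zTensor]⟩
  · exact Finset.mem_map.2 ⟨0, Finset.mem_univ _, zTensor_zero n⟩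
  · intro g hg h hh
    obtain ⟨a, -, rfl⟩ := Finset.mem_map.1 hg
    obtain ⟨b, -, rfl⟩ := Finset.mem_map.1 hh
    refine ⟨Finset.mem_map.2 ⟨a + b, Finset.mem_univ _, (zTensor_mul n a b).symm⟩, ?_⟩
    change zTensor n a * zTensor n b = zTensor n b * zTensor n a
    rw [zTensor_mul, zTensor_mul, add_comm]
  · simp
  · intro h
    obtain ⟨f, -, hf⟩ := Finset.mem_map.1 h
    change zTensor n f = -1 at hf
    have h0 : f = 0 := eq_zero_of_zTensor_eq_smul_one (c := -1) (by simp) (by simpa using hf)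
    rw [h0, zTensor_zero] at hf
    have := congr_arg Matrix.trace hf
    simp only [trace_neg, trace_one, Fintype.card_fin] at this
    exact (pow_ne_zero n (two_ne_zero (α := ℂ))) (by push_cast at this; exact self_eq_neg.1 this)

theorem wFree_eq_image (n : ℕ) : WFree n = Wig n '' convexHull ℝ (Stab n) := by
  have : {w | ∃ σ ∈ Stab n, w = Wig n σ} = wigLinear n '' Stab n := by
    ext w
    exact exists_congr fun σ => and_congr_right fun _ => eq_comm
  rw [WFree, this, ← LinearMap.image_convexHull]
  rfl

theorem isCompact_wFree (n : ℕ) : IsCompact (WFree n) := by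
  refine Set.Finite.isCompact_convexHull ℝ (((finite_stab n).image (Wig n)).subset ?_)
  rintro _ ⟨σ, hσ, rfl⟩
  exact ⟨σ, hσ, rfl⟩

theorem wFree_nonempty (n : ℕ) : (WFree n).Nonempty := by
  rw [wFree_eq_image]
  exact ((stab_nonempty n).convexHull).image _

theorem l1_eq_zero {n : ℕ} {v : (Fin n → ZMod 2 × ZMod 2) → ℝ} : l1 v = 0 ↔ v = 0 := by
  simp [l1, Finset.sum_eq_zero_iff_of_nonneg, funext_iff]

theorem Cdist_eq_zero_iff_wig_mem_wFree (n : ℕ) (ρ : Matrix (Fin (2 ^ n)) (Fin (2 ^ n)) ℂ) :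
    Cdist n ρ = 0 ↔ Wig n ρ ∈ WFree n := by
  have himage : {d | ∃ f ∈ WFree n, d = l1 (Wig n ρ - f)}
      = (fun f => l1 (Wig n ρ - f)) '' WFree n := by
    ext d
    exact exists_congr fun f => and_congr_right fun _ => eq_comm
  rw [Cdist, himage]
  constructor
  · intro h
    have hcont : Continuous fun f => l1 (Wig n ρ - f) := by
      unfold l1
      fun_prop
    obtain ⟨f, hf, hd⟩ :=
      ((isCompact_wFree n).image hcont).sInf_mem ((wFree_nonempty n).image _)
    rw [h] at hd
    rwa [sub_eq_zero.1 (l1_eq_zero.1 hd)]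
  · intro h
    refine IsLeast.csInf_eq ⟨⟨_, h, l1_eq_zero.2 (sub_self _)⟩, ?_⟩
    rintro _ ⟨f, -, rfl⟩
    exact Finset.sum_nonneg fun _ _ => abs_nonneg _

/-- the Wigner distance vanishes exactly on mixtures of stabilizer states. -/
theorem Cdist_eq_zero_iff_mem_convexHull_stab (n : ℕ) (hn : 1 ≤ n)
    (ρ : Matrix (Fin (2 ^ n)) (Fin (2 ^ n)) ℂ) (hρ : IsDensity ρ) :
    Cdist n ρ = 0 ↔ ρ ∈ convexHull ℝ (Stab n) := by
  rw [Cdist_eq_zero_iff_wig_mem_wFree, wFree_eq_image]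
  refine ⟨?_, Set.mem_image_of_mem _⟩
  rintro ⟨σ, hσ, h⟩
  rwa [← eq_of_wig_eq (isHermitian_of_mem_convexHull_stab hσ) hρ.1.isHermitian h]
end
end

section
/- The single-qubit Wigner distance is invariant under single-qubit Clifford unitaries: if U is a 2×2 unitary matrix such that for each P ∈ {X, Y, Z} there exist Q ∈ {X, Y, Z} and ε ∈ {−1, 1} with U·P·U† = ε·Q, then C(U·ρ·U†) = C(ρ) for every density matrix ρ on ℂ². -/
open Matrix Kronecker Finset
open scoped ComplexOrder

noncomputable section

/-- The single-qubit Pauli group `P₁`. -/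
def Pauli1 : Set (Matrix (Fin 2) (Fin 2) ℂ) :=
  { M | ∃ (k : Fin 4) (P : Fin 4), M = Complex.I ^ (k : ℕ) • pauli P }

/-- `S` is an abelian subgroup of `P₁` with `|S| = 2` and `-I ∉ S`. -/
def IsStabGroup1 (S : Finset (Matrix (Fin 2) (Fin 2) ℂ)) : Prop :=
  (∀ g ∈ S, g ∈ Pauli1) ∧ (1 : Matrix (Fin 2) (Fin 2) ℂ) ∈ S ∧
  (∀ g ∈ S, ∀ h ∈ S, g * h ∈ S ∧ g * h = h * g) ∧
  S.card = 2 ∧ (-1 : Matrix (Fin 2) (Fin 2) ℂ) ∉ S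

/-- The six pure single-qubit stabilizer states. -/
def Stab1 : Set (Matrix (Fin 2) (Fin 2) ℂ) :=
  { σ | ∃ S : Finset (Matrix (Fin 2) (Fin 2) ℂ),
      IsStabGroup1 S ∧ σ = (2 : ℂ)⁻¹ • ∑ g ∈ S, g }

/-- Single-qubit discrete Wigner function. -/
def W1 (ρ : Matrix (Fin 2) (Fin 2) ℂ) (a : ZMod 2 × ZMod 2) : ℝ :=
  ((2 : ℂ)⁻¹ * (ρ * A1 a).trace).re

/-- Single-qubit free Wigner polytope. -/
def WFree1 : Set ((ZMod 2 × ZMod 2) → ℝ) :=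
  convexHull ℝ { w | ∃ σ ∈ Stab1, w = W1 σ }

/-- Single-qubit Wigner distance `C(ρ)`. -/
def C1 (ρ : Matrix (Fin 2) (Fin 2) ℂ) : ℝ :=
  sInf { d | ∃ f ∈ WFree1, d = ∑ a, |W1 ρ a - f a| }

/-- Conjugation by the unitary `U` maps each of `X`, `Y`, `Z` to one of `±X`, `±Y`, `±Z`. -/
def IsClifford1 (U : Matrix (Fin 2) (Fin 2) ℂ) : Prop :=
  U ∈ Matrix.unitaryGroup (Fin 2) ℂ ∧ ∀ i : Fin 3, ∃ j : Fin 3, ∃ ε : ℝ,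
    (ε = 1 ∨ ε = -1) ∧ U * pauli i.succ * Uᴴ = ε • pauli j.succ

theorem conjTranspose_mul_self_of_mem_unitary {U : Matrix (Fin 2) (Fin 2) ℂ}
    (hU : U ∈ Matrix.unitaryGroup (Fin 2) ℂ) : Uᴴ * U = 1 :=
  Matrix.mem_unitaryGroup_iff'.1 hU

theorem mul_conjTranspose_self_of_mem_unitary {U : Matrix (Fin 2) (Fin 2) ℂ}
    (hU : U ∈ Matrix.unitaryGroup (Fin 2) ℂ) : U * Uᴴ = 1 :=
  Matrix.mem_unitaryGroup_iff.1 hU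

theorem conjTranspose_conj_conj {U : Matrix (Fin 2) (Fin 2) ℂ}
    (hU : U ∈ Matrix.unitaryGroup (Fin 2) ℂ) (M : Matrix (Fin 2) (Fin 2) ℂ) :
    Uᴴ * (U * M * Uᴴ) * U = M := by
  have h := conjTranspose_mul_self_of_mem_unitary hU
  calc Uᴴ * (U * M * Uᴴ) * U = (Uᴴ * U) * M * (Uᴴ * U) := by simp only [Matrix.mul_assoc]
    _ = M := by rw [h, Matrix.one_mul, Matrix.mul_one]

theorem unitary_conj_injective {U : Matrix (Fin 2) (Fin 2) ℂ}
    (hU : U ∈ Matrix.unitaryGroup (Fin 2) ℂ) :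
    Function.Injective fun M : Matrix (Fin 2) (Fin 2) ℂ => U * M * Uᴴ := by
  intro M N h
  rw [← conjTranspose_conj_conj hU M, ← conjTranspose_conj_conj hU N]
  exact congrArg (fun K => Uᴴ * K * U) h

theorem unitary_conj_mul {U : Matrix (Fin 2) (Fin 2) ℂ}
    (hU : U ∈ Matrix.unitaryGroup (Fin 2) ℂ) (M N : Matrix (Fin 2) (Fin 2) ℂ) :
    U * M * Uᴴ * (U * N * Uᴴ) = U * (M * N) * Uᴴ := by
  have h := conjTranspose_mul_self_of_mem_unitary hU
  calc U * M * Uᴴ * (U * N * Uᴴ) = U * M * (Uᴴ * U) * N * Uᴴ := by simp only [Matrix.mul_assoc]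
    _ = _ := by rw [h, Matrix.mul_one, Matrix.mul_assoc U M N]

/-- Distinct Pauli matrices are not proportional by a sign. -/
theorem eq_of_pauli_succ_eq_smul {i j : Fin 3} {c : ℝ}
    (h : pauli i.succ = c • pauli j.succ) : i = j := by
  have h00 := congrFun (congrFun h 0) 0
  have h01 := congrFun (congrFun h 0) 1
  have h10 := congrFun (congrFun h 1) 0
  fin_cases i <;> fin_cases j <;>
    simp_all [pauli, PX, PY, PZ, Complex.ext_iff]

theorem IsClifford1.exists_signed_perm {U : Matrix (Fin 2) (Fin 2) ℂ} (h : IsClifford1 U) :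
    ∃ (σ : Fin 3 → Fin 3) (ε : Fin 3 → ℝ), Function.Injective σ ∧ (∀ i, ε i = 1 ∨ ε i = -1) ∧
      ∀ i, U * pauli i.succ * Uᴴ = ε i • pauli (σ i).succ := by
  obtain ⟨hU, hc⟩ := h
  choose σ ε hε hc using hc
  refine ⟨σ, ε, fun i j hij => ?_, hε, hc⟩
  apply eq_of_pauli_succ_eq_smul (c := ε i * ε j)
  apply unitary_conj_injective hU
  have hsq : ε j * ε j = 1 := by rcases hε j with h | h <;> simp [h]
  simp only [Matrix.mul_smul, Matrix.smul_mul, hc, hij, smul_smul]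
  rw [mul_assoc, hsq, mul_one]

theorem IsClifford1.conjTranspose {U : Matrix (Fin 2) (Fin 2) ℂ} (h : IsClifford1 U) :
    IsClifford1 Uᴴ := by
  obtain ⟨σ, ε, hinj, hε, hc⟩ := h.exists_signed_perm
  refine ⟨Unitary.star_mem h.1, ?_⟩
  have hsq : ∀ i, ε i * ε i = 1 := fun i => by rcases hε i with h | h <;> simp [h]
  intro j
  obtain ⟨i, rfl⟩ := (Finite.injective_iff_surjective.1 hinj) j
  refine ⟨i, ε i, hε i, ?_⟩
  have hσ : pauli (σ i).succ = ε i • (U * pauli i.succ * Uᴴ) := by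
    rw [hc, smul_smul, hsq, one_smul]
  rw [Matrix.conjTranspose_conjTranspose, hσ, Matrix.mul_smul, Matrix.smul_mul,
    conjTranspose_conj_conj h.1]

theorem smul_mem_Pauli1 {ε : ℝ} (hε : ε = 1 ∨ ε = -1) {M : Matrix (Fin 2) (Fin 2) ℂ}
    (hM : M ∈ Pauli1) : ε • M ∈ Pauli1 := by
  rcases hε with rfl | rfl
  · simpa using hM
  · obtain ⟨k, P, rfl⟩ := hM
    refine ⟨k + 2, P, ?_⟩
    rw [neg_one_smul, ← neg_smul]
    congr 1
    fin_cases k <;> simp [pow_succ]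

theorem IsClifford1.conj_mem_Pauli1 {U : Matrix (Fin 2) (Fin 2) ℂ} (h : IsClifford1 U)
    {M : Matrix (Fin 2) (Fin 2) ℂ} (hM : M ∈ Pauli1) : U * M * Uᴴ ∈ Pauli1 := by
  obtain ⟨k, P, rfl⟩ := hM
  rw [Matrix.mul_smul, Matrix.smul_mul]
  induction P using Fin.cases with
  | zero =>
    refine ⟨k, 0, ?_⟩
    simp [pauli, mul_conjTranspose_self_of_mem_unitary h.1]
  | succ i =>
    obtain ⟨j, ε, hε, hij⟩ := h.2 i
    rw [hij, smul_comm]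
    exact smul_mem_Pauli1 hε ⟨k, j.succ, rfl⟩

theorem IsClifford1.conj_mem_Stab1 {U : Matrix (Fin 2) (Fin 2) ℂ} (h : IsClifford1 U)
    {σ : Matrix (Fin 2) (Fin 2) ℂ} (hσ : σ ∈ Stab1) : U * σ * Uᴴ ∈ Stab1 := by
  classical
  obtain ⟨S, ⟨hP, h1, hmul, hcard, hneg⟩, rfl⟩ := hσ
  have hinj := unitary_conj_injective h.1
  have hone := mul_conjTranspose_self_of_mem_unitary h.1
  refine ⟨S.image fun M => U * M * Uᴴ, ⟨?_, ?_, ?_, ?_, ?_⟩, ?_⟩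
  · simp only [Finset.forall_mem_image]
    exact fun g hg => h.conj_mem_Pauli1 (hP g hg)
  · exact Finset.mem_image.2 ⟨1, h1, by rw [Matrix.mul_one, hone]⟩
  · simp only [Finset.forall_mem_image]
    intro g hg k hk
    rw [unitary_conj_mul h.1, unitary_conj_mul h.1, ← (hmul g hg k hk).2]
    exact ⟨Finset.mem_image_of_mem _ (hmul g hg k hk).1, rfl⟩
  · rw [Finset.card_image_of_injective _ hinj, hcard]
  · intro hm
    obtain ⟨g, hg, hg'⟩ := Finset.mem_image.1 hm
    have : g = -1 := hinj (by simp only [hg', Matrix.mul_neg, Matrix.neg_mul, Matrix.mul_one, hone])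
    exact hneg (this ▸ hg)
  · rw [Finset.sum_image hinj.injOn, Matrix.mul_smul, Matrix.smul_mul, Finset.mul_sum,
      Finset.sum_mul]

theorem trace_of_mem_Stab1 {σ : Matrix (Fin 2) (Fin 2) ℂ} (hσ : σ ∈ Stab1) : σ.trace = 1 := by
  classical
  obtain ⟨S, ⟨hP, h1, hmul, hcard, hneg⟩, rfl⟩ := hσ
  obtain ⟨g, hg⟩ := Finset.card_eq_one.1
    (show (S.erase 1).card = 1 by rw [Finset.card_erase_of_mem h1, hcard])
  obtain ⟨hg1, hgS⟩ : g ≠ 1 ∧ g ∈ S := Finset.mem_erase.1 (hg ▸ Finset.mem_singleton_self g)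
  have hgt : g.trace = 0 := by
    have hsq := (hmul g hgS g hgS).1
    have hgn : g ≠ -1 := fun h => hneg (h ▸ hgS)
    have hsqn : g * g ≠ -1 := fun h => hneg (h ▸ hsq)
    obtain ⟨k, P, rfl⟩ := hP g hgS
    fin_cases P
    · exfalso
      fin_cases k <;> simp [pauli, pow_succ, smul_smul] at hg1 hgn hsqn
    all_goals simp [pauli, PX, PY, PZ, Matrix.trace_fin_two]
  rw [← Finset.add_sum_erase S _ h1, hg, Finset.sum_singleton, Matrix.trace_smul,
    Matrix.trace_add, hgt]
  simp

theorem trace_of_mem_convexHull_Stab1 {τ : Matrix (Fin 2) (Fin 2) ℂ}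
    (hτ : τ ∈ convexHull ℝ Stab1) : τ.trace = 1 := by
  have hconv : Convex ℝ {τ : Matrix (Fin 2) (Fin 2) ℂ | τ.trace = 1} :=
    (convex_singleton (1 : ℂ)).linear_preimage (Matrix.traceLinearMap (Fin 2) ℝ ℂ)
  exact convexHull_min (fun σ hσ => trace_of_mem_Stab1 hσ) hconv hτ

/-- The Wigner function as a real-linear map. -/
def W1Linear : Matrix (Fin 2) (Fin 2) ℂ →ₗ[ℝ] (ZMod 2 × ZMod 2 → ℝ) where
  toFun := W1
  map_add' M N := by
    funext a
    simp [W1, Matrix.add_mul, mul_add]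
  map_smul' c M := by
    funext a
    simp [W1]
    ring

theorem WFree1_eq_image : WFree1 = W1 '' convexHull ℝ Stab1 := by
  rw [WFree1, show W1 = W1Linear from rfl, LinearMap.image_convexHull]
  congr 1
  ext w
  simp only [Set.mem_ofPred_eq, Set.mem_image, eq_comm]

/-- Conjugation by `U` as a real-linear map. -/
def conjLinear (U : Matrix (Fin 2) (Fin 2) ℂ) :
    Matrix (Fin 2) (Fin 2) ℂ →ₗ[ℝ] Matrix (Fin 2) (Fin 2) ℂ where
  toFun M := U * M * Uᴴ
  map_add' M N := by rw [Matrix.mul_add, Matrix.add_mul]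
  map_smul' c M := by rw [Matrix.mul_smul, Matrix.smul_mul, RingHom.id_apply]

theorem IsClifford1.conj_mem_convexHull_Stab1 {U : Matrix (Fin 2) (Fin 2) ℂ}
    (h : IsClifford1 U) {τ : Matrix (Fin 2) (Fin 2) ℂ} (hτ : τ ∈ convexHull ℝ Stab1) :
    U * τ * Uᴴ ∈ convexHull ℝ Stab1 := by
  have hsub : conjLinear U '' Stab1 ⊆ Stab1 := by
    rintro _ ⟨σ, hσ, rfl⟩
    exact h.conj_mem_Stab1 hσ
  apply convexHull_mono hsub
  rw [← LinearMap.image_convexHull]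
  exact ⟨τ, hτ, rfl⟩

/-- Four times the `ℓ¹` norm of the Wigner function of a traceless operator, as a function of the
Bloch vector. -/
def blochNorm (x y z : ℝ) : ℝ :=
  |x + y + z| + |x - y - z| + |y - x - z| + |z - x - y|

theorem blochNorm_swap_left (x y z : ℝ) : blochNorm x y z = blochNorm y x z := by
  unfold blochNorm
  rw [add_comm x y, sub_right_comm z x y]
  ring

theorem blochNorm_swap_right (x y z : ℝ) : blochNorm x y z = blochNorm x z y := by
  unfold blochNorm
  rw [add_right_comm x y z, sub_right_comm x y z, sub_right_comm y x z, sub_right_comm z x y]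
  ring_nf

theorem blochNorm_neg_left (x y z : ℝ) : blochNorm (-x) y z = blochNorm x y z := by
  unfold blochNorm
  rw [show -x + y + z = -(x - y - z) by ring, show -x - y - z = -(x + y + z) by ring,
    show y - -x - z = -(z - x - y) by ring, show z - -x - y = -(y - x - z) by ring]
  simp only [abs_neg]
  ring

theorem blochNorm_neg_middle (x y z : ℝ) : blochNorm x (-y) z = blochNorm x y z := by
  rw [blochNorm_swap_left, blochNorm_neg_left, blochNorm_swap_left]

theorem blochNorm_neg_right (x y z : ℝ) : blochNorm x y (-z) = blochNorm x y z := by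
  rw [blochNorm_swap_right, blochNorm_neg_middle, blochNorm_swap_right]

theorem blochNorm_signed_perm (v : Fin 3 → ℝ) {σ : Fin 3 → Fin 3} (hσ : Function.Injective σ)
    {ε : Fin 3 → ℝ} (hε : ∀ i, ε i = 1 ∨ ε i = -1) :
    blochNorm (ε 0 * v (σ 0)) (ε 1 * v (σ 1)) (ε 2 * v (σ 2)) = blochNorm (v 0) (v 1) (v 2) := by
  have hsign : blochNorm (ε 0 * v (σ 0)) (ε 1 * v (σ 1)) (ε 2 * v (σ 2)) =
      blochNorm (v (σ 0)) (v (σ 1)) (v (σ 2)) := by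
    rcases hε 0 with h0 | h0 <;> rcases hε 1 with h1 | h1 <;> rcases hε 2 with h2 | h2 <;>
      simp only [h0, h1, h2, one_mul, neg_one_mul, blochNorm_neg_left, blochNorm_neg_middle,
        blochNorm_neg_right]
  rw [hsign]
  have h01 : σ 0 ≠ σ 1 := hσ.ne (by decide)
  have h02 : σ 0 ≠ σ 2 := hσ.ne (by decide)
  have h12 : σ 1 ≠ σ 2 := hσ.ne (by decide)
  generalize σ 0 = a at *
  generalize σ 1 = b at *
  generalize σ 2 = c at *
  have hL := blochNorm_swap_left
  have hR := blochNorm_swap_right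
  fin_cases a <;> fin_cases b <;> fin_cases c <;> first | contradiction | skip
  · rfl
  · exact hR _ _ _
  · exact hL _ _ _
  · exact (hR _ _ _).trans (hL _ _ _)
  · exact (hL _ _ _).trans (hR _ _ _)
  · exact (hL _ _ _).trans ((hR _ _ _).trans (hL _ _ _))

/-- The coordinates of the Bloch vector. -/
def bloch (M : Matrix (Fin 2) (Fin 2) ℂ) (i : Fin 3) : ℝ := (M * pauli i.succ).trace.re

theorem sum_abs_W1_of_trace_eq_zero {M : Matrix (Fin 2) (Fin 2) ℂ} (hM : M.trace = 0) :
    ∑ a, |W1 M a| = 4⁻¹ * blochNorm (bloch M 0) (bloch M 1) (bloch M 2) := by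
  have hW : ∀ a, W1 M a = 4⁻¹ * ((-1) ^ a.2.val * bloch M 0 +
      (-1) ^ (a.1.val + a.2.val) * bloch M 1 + (-1) ^ a.1.val * bloch M 2) := by
    intro a
    have hre : ∀ n : ℕ, (((-1 : ℂ)) ^ n) = (((-1 : ℝ) ^ n : ℝ) : ℂ) := fun n => by push_cast; rfl
    have h4 : ∀ z : ℂ, (2 : ℂ)⁻¹ * (1 / 2 * z) = ((4⁻¹ : ℝ) : ℂ) * z := fun z => by
      push_cast; ring
    simp only [W1, A1, bloch, pauli, Matrix.mul_smul, Matrix.mul_add, Matrix.trace_smul,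
      Matrix.trace_add, Matrix.mul_one, hM, zero_add, smul_eq_mul, hre, h4, Complex.re_ofReal_mul,
      Complex.add_re]
    rfl
  have hsum : ∀ f : ZMod 2 × ZMod 2 → ℝ, ∑ a, f a = f (0, 0) + f (0, 1) + (f (1, 0) + f (1, 1)) :=
    fun f => by
      rw [Fintype.sum_prod_type]
      exact (Fin.sum_univ_two _).trans (congrArg₂ _ (Fin.sum_univ_two _) (Fin.sum_univ_two _))
  have h1 : (1 : ZMod 2).val = 1 := rfl
  simp only [hsum, hW, abs_mul, blochNorm, ZMod.val_zero, h1]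
  rw [abs_of_pos (show (0 : ℝ) < 4⁻¹ by norm_num)]
  norm_num
  ring_nf

theorem IsClifford1.sum_abs_W1_conj {U : Matrix (Fin 2) (Fin 2) ℂ} (h : IsClifford1 U)
    {M : Matrix (Fin 2) (Fin 2) ℂ} (hM : M.trace = 0) :
    ∑ a, |W1 (U * M * Uᴴ) a| = ∑ a, |W1 M a| := by
  have hM' : (U * M * Uᴴ).trace = 0 := by
    rw [Matrix.trace_mul_comm, ← Matrix.mul_assoc, conjTranspose_mul_self_of_mem_unitary h.1,
      Matrix.one_mul, hM]
  obtain ⟨σ, ε, hinj, hε, hc⟩ := h.conjTranspose.exists_signed_perm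
  have hb : ∀ i, bloch (U * M * Uᴴ) i = ε i * bloch M (σ i) := by
    intro i
    have : (U * M * Uᴴ * pauli i.succ).trace = (M * (Uᴴ * pauli i.succ * Uᴴᴴ)).trace := by
      rw [Matrix.conjTranspose_conjTranspose, Matrix.mul_assoc U, Matrix.mul_assoc U,
        Matrix.trace_mul_comm U]
      simp only [Matrix.mul_assoc]
    rw [bloch, this, hc, Matrix.mul_smul, Matrix.trace_smul, Complex.smul_re, smul_eq_mul, bloch]
  rw [sum_abs_W1_of_trace_eq_zero hM', sum_abs_W1_of_trace_eq_zero hM, hb, hb, hb,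
    blochNorm_signed_perm _ hinj hε]

theorem IsClifford1.distances_subset {U : Matrix (Fin 2) (Fin 2) ℂ} (h : IsClifford1 U)
    {ρ : Matrix (Fin 2) (Fin 2) ℂ} (hρ : ρ.trace = 1) :
    {d | ∃ f ∈ WFree1, d = ∑ a, |W1 ρ a - f a|} ⊆
      {d | ∃ f ∈ WFree1, d = ∑ a, |W1 (U * ρ * Uᴴ) a - f a|} := by
  rintro _ ⟨f, hf, rfl⟩
  rw [WFree1_eq_image] at hf ⊢
  obtain ⟨τ, hτ, rfl⟩ := hf
  refine ⟨_, ⟨_, h.conj_mem_convexHull_Stab1 hτ, rfl⟩, ?_⟩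
  have hsub : ∀ M N a, W1 M a - W1 N a = W1 (M - N) a := fun M N a =>
    (congrFun (map_sub W1Linear M N) a).symm
  simp only [hsub]
  rw [← Matrix.sub_mul, ← Matrix.mul_sub, h.sum_abs_W1_conj]
  rw [Matrix.trace_sub, hρ, trace_of_mem_convexHull_Stab1 hτ, sub_self]

/-- the single-qubit Wigner distance is invariant under
single-qubit Clifford unitaries. -/
theorem C1_clifford_invariant (U : Matrix (Fin 2) (Fin 2) ℂ)
    (hU : U ∈ Matrix.unitaryGroup (Fin 2) ℂ)
    (hCl : ∀ P ∈ ({PX, PY, PZ} : Set (Matrix (Fin 2) (Fin 2) ℂ)),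
      ∃ Q ∈ ({PX, PY, PZ} : Set (Matrix (Fin 2) (Fin 2) ℂ)), ∃ ε : ℝ,
        (ε = 1 ∨ ε = -1) ∧ U * P * Uᴴ = ε • Q)
    (ρ : Matrix (Fin 2) (Fin 2) ℂ) (hρ : IsDensity ρ) :
    C1 (U * ρ * Uᴴ) = C1 ρ := by
  have h : IsClifford1 U := by
    refine ⟨hU, fun i => ?_⟩
    have hi : pauli i.succ ∈ ({PX, PY, PZ} : Set (Matrix (Fin 2) (Fin 2) ℂ)) := by
      fin_cases i <;> simp [pauli]
    obtain ⟨Q, hQ, ε, hε, hPQ⟩ := hCl _ hi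
    rcases hQ with rfl | rfl | rfl
    exacts [⟨0, ε, hε, hPQ⟩, ⟨1, ε, hε, hPQ⟩, ⟨2, ε, hε, hPQ⟩]
  have htr : (U * ρ * Uᴴ).trace = 1 := by
    rw [Matrix.trace_mul_comm, ← Matrix.mul_assoc, conjTranspose_mul_self_of_mem_unitary hU,
      Matrix.one_mul, hρ.2]
  have hrev := h.conjTranspose.distances_subset htr
  rw [Matrix.conjTranspose_conjTranspose, conjTranspose_conj_conj hU] at hrev
  exact congrArg sInf (hrev.antisymm (h.distances_subset hρ.2))
end
end
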